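/- Let e ∈ L \ {0,1}, S a t-conorm on [e,1], and cl a closure operator on L. Define U : L² → L by: U(x,y) = S(x,y) if (x,y) ∈ [e,1[²; U(x,y) = x if (x,y) ∈ ([0,e[ ∪ I_e) × {e} ∪ ]0,e[ × ]e,1[; U(x,y) = y if (x,y) ∈ {e} × ([0,e[ ∪ I_e) ∪ ]e,1[ × ]0,e[; U(x,y) = cl(x) ∧ (x ∨ e) if (x,y) ∈ I_e × ]e,1[; U(x,y) = cl(y) ∧ (y ∨ e) if (x,y) ∈ ]e,1[ × I_e; U(x,y) = 1 if (x,y) ∈ L × {1} ∪ {1} × L; and U(x,y) = 0 otherwise. Then: (1) if cl(x) ∉ [e,1] for all x ∈ I_e, then U is a uninorm on L with neutral element e if and only if S(x,y) < 1 for all x, y ∈ ]e,1[; (2) if ]e,1[ ≠ ∅, then U is a uninorm on L with neutral element e if and only if S(x,y) < 1 for all x, y ∈ ]e,1[ and cl(x) ∉ [e,1] for all x ∈ I_e. -/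

import Mathlib

/-- `Par a b` means that `a` and `b` are incomparable. -/
def Par {L : Type*} [Lattice L] (a b : L) : Prop := ¬ a ≤ b ∧ ¬ b ≤ a

section ClosureUninorm

variable {L : Type*} [Lattice L]

lemma monotone_of_map_sup {cl : L → L} (hcl_sup : ∀ x y, cl (x ⊔ y) = cl x ⊔ cl y) :
    Monotone cl := fun x y h => by
  have h' := hcl_sup x y
  rw [sup_eq_right.2 h] at h'
  exact h' ▸ le_sup_left

variable [BoundedOrder L]

/-- An element equals one of `⊥`, `e`, `⊤`, lies strictly between two of them, or is incomparable
to `e`. -/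
lemma eq_or_mem_Ioo_or_par (e x : L) :
    x = ⊥ ∨ x ∈ Set.Ioo ⊥ e ∨ x = e ∨ x ∈ Set.Ioo e ⊤ ∨ Par x e ∨ x = ⊤ := by
  by_cases h0 : x = ⊥
  · exact .inl h0
  by_cases h1 : x = ⊤
  · simp [h1]
  by_cases he : x = e
  · simp [he]
  by_cases hle : x ≤ e
  · exact .inr (.inl ⟨bot_lt_iff_ne_bot.2 h0, lt_of_le_of_ne hle he⟩)
  by_cases hge : e ≤ x
  · exact .inr (.inr (.inr (.inl ⟨lt_of_le_of_ne hge (Ne.symm he), lt_top_iff_ne_top.2 h1⟩)))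
  · exact .inr (.inr (.inr (.inr (.inl ⟨hle, hge⟩))))

lemma Par.ne_top {e x : L} (h : Par x e) : x ≠ ⊤ := fun hx => h.2 (hx ▸ le_top)

lemma Par.ne_bot {e x : L} (h : Par x e) : x ≠ ⊥ := fun hx => h.1 (hx ▸ bot_le)

/-- The operation `U` has top as annihilator, `e` as unit, and takes the values of the closure
construction on the remaining regions, up to swapping the arguments. -/
structure ClosureTable (e : L) (S : L → L → L) (cl : L → L) (U : L → L → L) : Prop where
  comm : ∀ x y, U x y = U y x
  top : ∀ x, U ⊤ x = ⊤
  unit : ∀ x, U e x = x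
  bot : ∀ x, x ≠ ⊤ → U ⊥ x = ⊥
  below_below : ∀ x ∈ Set.Ioo ⊥ e, ∀ y ∈ Set.Ioo ⊥ e, U x y = ⊥
  below_par : ∀ x ∈ Set.Ioo ⊥ e, ∀ y, Par y e → U x y = ⊥
  par_par : ∀ x, Par x e → ∀ y, Par y e → U x y = ⊥
  above_below : ∀ x ∈ Set.Ioo e ⊤, ∀ y ∈ Set.Ioo ⊥ e, U x y = y
  above_par : ∀ x ∈ Set.Ioo e ⊤, ∀ y, Par y e → U x y = cl y ⊓ (y ⊔ e)
  above_above : ∀ x ∈ Set.Ioo e ⊤, ∀ y ∈ Set.Ioo e ⊤, U x y = S x y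

namespace ClosureTable

variable {e : L} {S : L → L → L} {cl : L → L} {U : L → L → L}

lemma top' (T : ClosureTable e S cl U) (x : L) : U x ⊤ = ⊤ := by rw [T.comm, T.top]

lemma unit' (T : ClosureTable e S cl U) (x : L) : U x e = x := by rw [T.comm, T.unit]

lemma bot' (T : ClosureTable e S cl U) (x : L) (hx : x ≠ ⊤) : U x ⊥ = ⊥ := by
  rw [T.comm, T.bot x hx]

lemma par_below (T : ClosureTable e S cl U) : ∀ x, Par x e → ∀ y ∈ Set.Ioo ⊥ e, U x y = ⊥ :=
  fun x hx y hy => by rw [T.comm, T.below_par y hy x hx]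

lemma below_above (T : ClosureTable e S cl U) :
    ∀ x ∈ Set.Ioo ⊥ e, ∀ y ∈ Set.Ioo e ⊤, U x y = x :=
  fun x hx y hy => by rw [T.comm, T.above_below y hy x hx]

lemma par_above (T : ClosureTable e S cl U) :
    ∀ x, Par x e → ∀ y ∈ Set.Ioo e ⊤, U x y = cl x ⊓ (x ⊔ e) :=
  fun x hx y hy => by rw [T.comm, T.above_par y hy x hx]

lemma mul_lt_top_of_assoc (T : ClosureTable e S cl U) (he0 : e ≠ ⊥)
    (hassoc : ∀ x y z, U (U x y) z = U x (U y z)) :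
    ∀ x ∈ Set.Ioo e ⊤, ∀ y ∈ Set.Ioo e ⊤, S x y < ⊤ := by
  intro x hx y hy
  rw [lt_top_iff_ne_top]
  intro h
  have h1 := hassoc x y ⊥
  rw [T.above_above x hx y hy, h, T.top, T.bot' y hy.2.ne, T.bot' x hx.2.ne] at h1
  exact he0 (le_bot_iff.1 (h1 ▸ le_top))

lemma closure_notMem_of_assoc (T : ClosureTable e S cl U) (he0 : e ≠ ⊥) (hcl_le : ∀ x, x ≤ cl x)
    (hne : (Set.Ioo e ⊤).Nonempty) (hassoc : ∀ x y z, U (U x y) z = U x (U y z)) :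
    ∀ x, Par x e → cl x ∉ Set.Icc e ⊤ := by
  intro x hx hmem
  obtain ⟨y, hy⟩ := hne
  have hf : cl x ⊓ (x ⊔ e) = x ⊔ e := inf_eq_right.2 (sup_le (hcl_le x) hmem.1)
  have h := hassoc y x x
  rw [T.par_par x hx x hx, T.bot' y hy.2.ne, T.above_par y hy x hx, hf] at h
  by_cases hw : x ⊔ e = ⊤
  · rw [hw, T.top] at h
    exact he0 (le_bot_iff.1 (h ▸ le_top))
  · have hlt : e < x ⊔ e := lt_of_le_of_ne le_sup_right fun h => hx.1 (h ▸ le_sup_left)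
    rw [T.above_par _ ⟨hlt, lt_top_iff_ne_top.2 hw⟩ x hx, hf] at h
    exact he0 (le_bot_iff.1 (h ▸ le_sup_right))

lemma le_mul_above (T : ClosureTable e S cl U) (hcl_le : ∀ x, x ≤ cl x) :
    ∀ x, Par x e → ∀ y ∈ Set.Ioo e ⊤, x ≤ U x y := fun x hx y hy => by
  rw [T.par_above x hx y hy]; exact le_inf (hcl_le x) le_sup_left

lemma mono_left (T : ClosureTable e S cl U) (hcl : Monotone cl) (hcl_le : ∀ x, x ≤ cl x)
    (hle : ∀ x ∈ Set.Ioo e ⊤, ∀ y ∈ Set.Ioo e ⊤, x ≤ S x y ∧ y ≤ S x y)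
    (hmono : ∀ x ∈ Set.Ioo e ⊤, ∀ y ∈ Set.Ioo e ⊤, ∀ z ∈ Set.Ioo e ⊤, x ≤ y → S x z ≤ S y z)
    (x y z : L) (hxy : x ≤ y) : U x z ≤ U y z := by
  by_cases hzt : z = ⊤
  · simp [hzt, T.top']
  by_cases hyt : y = ⊤
  · simp [hyt, T.top]
  have hxt : x ≠ ⊤ := fun h => hyt (top_le_iff.1 (h ▸ hxy))
  rcases eq_or_mem_Ioo_or_par e x with rfl | hx | rfl | hx | hx | rfl
  · simp [T.bot z hzt]
  · rcases eq_or_mem_Ioo_or_par e z with rfl | hz | rfl | hz | hz | rfl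
    · simp [T.bot' x hxt]
    · simp [T.below_below x hx z hz]
    · simpa [T.unit'] using hxy
    · rw [T.below_above x hx z hz]
      rcases eq_or_mem_Ioo_or_par e y with rfl | hy | rfl | hy | hy | rfl
      · exact absurd (le_bot_iff.1 hxy) hx.1.ne'
      · rwa [T.below_above y hy z hz]
      · rw [T.unit]; exact hx.2.le.trans hz.1.le
      · rw [T.above_above y hy z hz]; exact hxy.trans (hle y hy z hz).1
      · exact hxy.trans (T.le_mul_above hcl_le y hy z hz)
      · exact absurd rfl hyt
    · simp [T.below_par x hx z hz]
    · exact absurd rfl hzt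
  · rw [T.unit]
    rcases eq_or_mem_Ioo_or_par x y with rfl | hy | rfl | hy | hy | rfl
    · obtain rfl := le_bot_iff.1 hxy
      rw [T.unit]
    · exact absurd hxy hy.2.not_ge
    · rw [T.unit]
    · rcases eq_or_mem_Ioo_or_par x z with rfl | hz | rfl | hz | hz | rfl
      · exact bot_le
      · rw [T.above_below y hy z hz]
      · rwa [T.unit']
      · rw [T.above_above y hy z hz]; exact (hle y hy z hz).2
      · rw [T.comm]; exact T.le_mul_above hcl_le z hz y hy
      · exact absurd rfl hzt
    · exact absurd hxy hy.2
    · exact absurd rfl hyt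
  · have hy : y ∈ Set.Ioo e ⊤ := ⟨hx.1.trans_le hxy, lt_top_iff_ne_top.2 hyt⟩
    rcases eq_or_mem_Ioo_or_par e z with rfl | hz | rfl | hz | hz | rfl
    · simp [T.bot' x hxt]
    · rw [T.above_below x hx z hz, T.above_below y hy z hz]
    · simpa [T.unit'] using hxy
    · rw [T.above_above x hx z hz, T.above_above y hy z hz]; exact hmono x hx y hy z hz hxy
    · rw [T.above_par x hx z hz, T.above_par y hy z hz]
    · exact absurd rfl hzt
  · rcases eq_or_mem_Ioo_or_par e z with rfl | hz | rfl | hz | hz | rfl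
    · simp [T.bot' x hxt]
    · simp [T.par_below x hx z hz]
    · simpa [T.unit'] using hxy
    · rw [T.par_above x hx z hz]
      rcases eq_or_mem_Ioo_or_par e y with rfl | hy | rfl | hy | hy | rfl
      · exact absurd (hxy.trans bot_le) hx.1
      · exact absurd (hxy.trans hy.2.le) hx.1
      · exact absurd hxy hx.1
      · rw [T.above_above y hy z hz]
        exact inf_le_right.trans ((sup_le hxy hy.1.le).trans (hle y hy z hz).1)
      · rw [T.par_above y hy z hz]
        exact inf_le_inf (hcl hxy) (sup_le_sup_right hxy e)
      · exact absurd rfl hyt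
    · simp [T.par_par x hx z hz]
    · exact absurd rfl hzt
  · exact absurd rfl hxt

lemma assoc (T : ClosureTable e S cl U) (he0 : e ≠ ⊥)
    (hcl : Monotone cl) (hcl_le : ∀ x, x ≤ cl x) (hcl_idem : ∀ x, cl (cl x) = cl x)
    (hS : ∀ x ∈ Set.Ioo e ⊤, ∀ y ∈ Set.Ioo e ⊤, S x y ∈ Set.Ioo e ⊤)
    (hS_assoc : ∀ x ∈ Set.Ioo e ⊤, ∀ y ∈ Set.Ioo e ⊤, ∀ z ∈ Set.Ioo e ⊤,
      S (S x y) z = S x (S y z))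
    (hcl_mem : ∀ x, Par x e → cl x ∉ Set.Icc e ⊤) (x y z : L) :
    U (U x y) z = U x (U y z) := by
  have hpar : ∀ x, Par x e → Par (cl x ⊓ (x ⊔ e)) e := fun x hx =>
    ⟨fun h => hx.1 ((le_inf (hcl_le x) le_sup_left).trans h),
      fun h => hcl_mem x hx ⟨h.trans inf_le_left, le_top⟩⟩
  have hidem : ∀ x, cl (cl x ⊓ (x ⊔ e)) ⊓ ((cl x ⊓ (x ⊔ e)) ⊔ e) = cl x ⊓ (x ⊔ e) := by
    intro x
    have hx : x ≤ cl x ⊓ (x ⊔ e) := le_inf (hcl_le x) le_sup_left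
    have h1 : cl (cl x ⊓ (x ⊔ e)) = cl x :=
      le_antisymm ((hcl inf_le_left).trans (hcl_idem x).le) (hcl hx)
    have h2 : (cl x ⊓ (x ⊔ e)) ⊔ e = x ⊔ e :=
      le_antisymm (sup_le inf_le_right le_sup_right) (sup_le_sup_right hx e)
    rw [h1, h2]
  have hbt : (⊥ : L) ≠ ⊤ := fun h => he0 (le_bot_iff.1 (h ▸ le_top))
  have hne : ∀ x y, x ≠ ⊤ → y ≠ ⊤ → U x y ≠ ⊤ := by
    intro x y hxt hyt
    rcases eq_or_mem_Ioo_or_par e x with rfl | hx | rfl | hx | hx | rfl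
    · rwa [T.bot y hyt]
    · rcases eq_or_mem_Ioo_or_par e y with rfl | hy | rfl | hy | hy | rfl
      · rwa [T.bot' x hxt]
      · rwa [T.below_below x hx y hy]
      · rwa [T.unit']
      · rwa [T.below_above x hx y hy]
      · rwa [T.below_par x hx y hy]
      · exact absurd rfl hyt
    · rwa [T.unit]
    · rcases eq_or_mem_Ioo_or_par e y with rfl | hy | rfl | hy | hy | rfl
      · rwa [T.bot' x hxt]
      · rwa [T.above_below x hx y hy]
      · rwa [T.unit']
      · rw [T.above_above x hx y hy]; exact (hS x hx y hy).2.ne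
      · rw [T.above_par x hx y hy]; exact (hpar y hy).ne_top
      · exact absurd rfl hyt
    · rcases eq_or_mem_Ioo_or_par e y with rfl | hy | rfl | hy | hy | rfl
      · rwa [T.bot' x hxt]
      · rwa [T.par_below x hx y hy]
      · rwa [T.unit']
      · rw [T.par_above x hx y hy]; exact (hpar x hx).ne_top
      · rwa [T.par_par x hx y hy]
      · exact absurd rfl hyt
    · exact absurd rfl hxt
  by_cases hxt : x = ⊤
  · simp [hxt, T.top]
  by_cases hyt : y = ⊤
  · simp [hyt, T.top, T.top']
  by_cases hzt : z = ⊤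
  · simp [hzt, T.top']
  by_cases hx0 : x = ⊥
  · rw [hx0, T.bot y hyt, T.bot z hzt, T.bot _ (hne y z hyt hzt)]
  by_cases hy0 : y = ⊥
  · rw [hy0, T.bot' x hxt, T.bot z hzt, T.bot' x hxt]
  by_cases hz0 : z = ⊥
  · rw [hz0, T.bot' y hyt, T.bot' x hxt, T.bot' _ (hne x y hxt hyt)]
  by_cases hxe : x = e
  · simp only [hxe, T.unit]
  by_cases hye : y = e
  · simp only [hye, T.unit, T.unit']
  by_cases hze : z = e
  · simp only [hze, T.unit']
  have hregion : ∀ x, x ≠ ⊥ → x ≠ e → x ≠ ⊤ → x ∈ Set.Ioo ⊥ e ∨ x ∈ Set.Ioo e ⊤ ∨ Par x e := by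
    intro x h0 he ht
    simpa only [h0, he, ht, false_or, or_false] using eq_or_mem_Ioo_or_par e x
  rcases hregion x hx0 hxe hxt with hx | hx | hx <;>
    rcases hregion y hy0 hye hyt with hy | hy | hy <;>
      rcases hregion z hz0 hze hzt with hz | hz | hz <;>
        simp_all only [T.bot, T.bot', T.below_below, T.below_par, T.par_par, T.above_below,
          T.above_par, T.above_above, T.par_below, T.below_above, T.par_above, ne_eq,
          not_false_eq_true]

end ClosureTable

end ClosureUninorm

theorem uninorm_one_closure_top_iff' {L : Type*} [Lattice L] [BoundedOrder L]
    (e : L) (he0 : e ≠ ⊥) (he1 : e ≠ ⊤)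
    (S : L → L → L)
    (hS_mem : ∀ x ∈ Set.Icc e ⊤, ∀ y ∈ Set.Icc e ⊤, S x y ∈ Set.Icc e ⊤)
    (hS_comm : ∀ x ∈ Set.Icc e ⊤, ∀ y ∈ Set.Icc e ⊤, S x y = S y x)
    (hS_assoc : ∀ x ∈ Set.Icc e ⊤, ∀ y ∈ Set.Icc e ⊤, ∀ z ∈ Set.Icc e ⊤, S (S x y) z = S x (S y z))
    (hS_mono₁ : ∀ x ∈ Set.Icc e ⊤, ∀ y ∈ Set.Icc e ⊤, ∀ z ∈ Set.Icc e ⊤, x ≤ y → S x z ≤ S y z)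
    (hS_mono₂ : ∀ x ∈ Set.Icc e ⊤, ∀ y ∈ Set.Icc e ⊤, ∀ z ∈ Set.Icc e ⊤, x ≤ y → S z x ≤ S z y)
    (hS_unit : ∀ x ∈ Set.Icc e ⊤, S e x = x)
    (cl : L → L)
    (hcl_le : ∀ x, x ≤ cl x)
    (hcl_sup : ∀ x y, cl (x ⊔ y) = cl x ⊔ cl y)
    (hcl_idem : ∀ x, cl (cl x) = cl x)
    (U : L → L → L)
    (hU1 : ∀ x y, x ∈ Set.Ico e ⊤ ∧ y ∈ Set.Ico e ⊤ → U x y = S x y)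
    (hU2 : ∀ x y, ((x ∈ Set.Ico ⊥ e ∨ Par x e) ∧ y = e) ∨ (x ∈ Set.Ioo ⊥ e ∧ y ∈ Set.Ioo e ⊤) → U x y = x)
    (hU3 : ∀ x y, (x = e ∧ (y ∈ Set.Ico ⊥ e ∨ Par y e)) ∨ (x ∈ Set.Ioo e ⊤ ∧ y ∈ Set.Ioo ⊥ e) → U x y = y)
    (hU4 : ∀ x y, Par x e ∧ y ∈ Set.Ioo e ⊤ → U x y = cl x ⊓ (x ⊔ e))
    (hU5 : ∀ x y, x ∈ Set.Ioo e ⊤ ∧ Par y e → U x y = cl y ⊓ (y ⊔ e))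
    (hU6 : ∀ x y, x = ⊤ ∨ y = ⊤ → U x y = ⊤)
    (hU0 : ∀ x y, ¬(x ∈ Set.Ico e ⊤ ∧ y ∈ Set.Ico e ⊤) → ¬(((x ∈ Set.Ico ⊥ e ∨ Par x e) ∧ y = e) ∨ (x ∈ Set.Ioo ⊥ e ∧ y ∈ Set.Ioo e ⊤)) → ¬((x = e ∧ (y ∈ Set.Ico ⊥ e ∨ Par y e)) ∨ (x ∈ Set.Ioo e ⊤ ∧ y ∈ Set.Ioo ⊥ e)) → ¬(Par x e ∧ y ∈ Set.Ioo e ⊤) → ¬(x ∈ Set.Ioo e ⊤ ∧ Par y e) → ¬(x = ⊤ ∨ y = ⊤) → U x y = ⊥)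
    :
    ((∀ x, Par x e → cl x ∉ Set.Icc e ⊤) →
        (((∀ x y, U x y = U y x) ∧ (∀ x y z, U (U x y) z = U x (U y z)) ∧
      (∀ x y z, x ≤ y → U x z ≤ U y z) ∧ (∀ x y z, x ≤ y → U z x ≤ U z y) ∧
      (∀ x, U e x = x)) ↔ (∀ x ∈ Set.Ioo e ⊤, ∀ y ∈ Set.Ioo e ⊤, S x y < ⊤))) ∧
    ((Set.Ioo e ⊤).Nonempty →
        (((∀ x y, U x y = U y x) ∧ (∀ x y z, U (U x y) z = U x (U y z)) ∧
      (∀ x y z, x ≤ y → U x z ≤ U y z) ∧ (∀ x y z, x ≤ y → U z x ≤ U z y) ∧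
      (∀ x, U e x = x)) ↔ ((∀ x ∈ Set.Ioo e ⊤, ∀ y ∈ Set.Ioo e ⊤, S x y < ⊤) ∧ (∀ x, Par x e → cl x ∉ Set.Icc e ⊤)))) := by
  have hcl := monotone_of_map_sup hcl_sup
  have hIcc : ∀ x ∈ Set.Ioo e ⊤, x ∈ Set.Icc e ⊤ := fun x hx => Set.Ioo_subset_Icc_self hx
  have heI : e ∈ Set.Icc e ⊤ := ⟨le_rfl, le_top⟩
  have heO : e ∈ Set.Ico e ⊤ := ⟨le_rfl, lt_top_iff_ne_top.2 he1⟩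
  have hle : ∀ x ∈ Set.Ioo e ⊤, ∀ y ∈ Set.Ioo e ⊤, x ≤ S x y ∧ y ≤ S x y := by
    intro x hx y hy
    have hr : ∀ x ∈ Set.Ioo e ⊤, ∀ y ∈ Set.Ioo e ⊤, y ≤ S x y := fun x hx y hy => by
      simpa [hS_unit y (hIcc y hy)] using
        hS_mono₁ e heI x (hIcc x hx) y (hIcc y hy) hx.1.le
    exact ⟨hS_comm x (hIcc x hx) y (hIcc y hy) ▸ hr y hy x hx, hr x hx y hy⟩
  have T : ClosureTable e S cl U := by
    have hUe : ∀ x, U e x = x := fun x => by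
      rcases eq_or_mem_Ioo_or_par e x with rfl | hx | rfl | hx | hx | rfl
      · exact hU3 _ _ (.inl ⟨rfl, .inl ⟨le_rfl, bot_lt_iff_ne_bot.2 he0⟩⟩)
      · exact hU3 _ _ (.inl ⟨rfl, .inl ⟨hx.1.le, hx.2⟩⟩)
      · rw [hU1 _ _ ⟨heO, heO⟩, hS_unit x heI]
      · rw [hU1 _ _ ⟨heO, hx.1.le, hx.2⟩, hS_unit x (hIcc x hx)]
      · exact hU3 _ _ (.inl ⟨rfl, .inr hx⟩)
      · exact hU6 _ _ (.inr rfl)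
    have hcomm : ∀ x y, U x y = U y x := by
      intro x y
      by_cases h6 : x = ⊤ ∨ y = ⊤
      · rw [hU6 x y h6, hU6 y x h6.symm]
      by_cases h1 : x ∈ Set.Ico e ⊤ ∧ y ∈ Set.Ico e ⊤
      · rw [hU1 x y h1, hU1 y x h1.symm,
          hS_comm x ⟨h1.1.1, le_top⟩ y ⟨h1.2.1, le_top⟩]
      by_cases h2 : ((x ∈ Set.Ico ⊥ e ∨ Par x e) ∧ y = e) ∨ (x ∈ Set.Ioo ⊥ e ∧ y ∈ Set.Ioo e ⊤)
      · rw [hU2 x y h2, hU3 y x (h2.imp And.symm And.symm)]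
      by_cases h3 : (x = e ∧ (y ∈ Set.Ico ⊥ e ∨ Par y e)) ∨ (x ∈ Set.Ioo e ⊤ ∧ y ∈ Set.Ioo ⊥ e)
      · rw [hU3 x y h3, hU2 y x (h3.imp And.symm And.symm)]
      by_cases h4 : Par x e ∧ y ∈ Set.Ioo e ⊤
      · rw [hU4 x y h4, hU5 y x h4.symm]
      by_cases h5 : x ∈ Set.Ioo e ⊤ ∧ Par y e
      · rw [hU5 x y h5, hU4 y x h5.symm]
      · rw [hU0 x y h1 h2 h3 h4 h5 h6, hU0 y x (mt And.symm h1)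
          (mt (Or.imp And.symm And.symm) h3) (mt (Or.imp And.symm And.symm) h2)
          (mt And.symm h5) (mt And.symm h4) (mt Or.symm h6)]
    have hzero : ∀ x y, ¬ e ≤ x → ¬ e ≤ y → U x y = ⊥ := by
      intro x y hx hy
      refine hU0 x y (fun h => hx h.1.1) ?_ ?_ (fun h => hy h.2.1.le) (fun h => hx h.1.1.le) ?_
      · rintro (h | h)
        exacts [hy h.2.ge, hy h.2.1.le]
      · rintro (h | h)
        exacts [hx h.1.ge, hx h.1.1.le]
      · rintro (rfl | rfl)
        exacts [hx le_top, hy le_top]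
    have hb : ¬ e ≤ ⊥ := fun h => he0 (le_bot_iff.1 h)
    refine ⟨hcomm, fun x => hU6 _ _ (.inl rfl), hUe, ?_,
      fun x hx y hy => hzero x y hx.2.not_ge hy.2.not_ge,
      fun x hx y hy => hzero x y hx.2.not_ge hy.2,
      fun x hx y hy => hzero x y hx.2 hy.2,
      fun x hx y hy => hU3 x y (.inr ⟨hx, hy⟩),
      fun x hx y hy => hU5 x y ⟨hx, hy⟩,
      fun x hx y hy => hU1 x y ⟨⟨hx.1.le, hx.2⟩, ⟨hy.1.le, hy.2⟩⟩⟩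
    intro x hx
    by_cases hxe : e ≤ x
    · rcases hxe.eq_or_lt with rfl | hlt
      · rw [hcomm, hUe]
      · refine hU0 ⊥ x (fun h => hb h.1.1) ?_ ?_ (fun h => h.1.1 bot_le) (fun h => hb h.1.1.le) ?_
        · rintro (h | h)
          exacts [hlt.ne' h.2, lt_irrefl _ h.1.1]
        · rintro (h | h)
          exacts [he0 h.1.symm, hb h.1.1.le]
        · rintro (h | h)
          exacts [hb (h ▸ le_top), hx h]
    · exact hzero _ _ hb hxe
  have hback (hlt : ∀ x ∈ Set.Ioo e ⊤, ∀ y ∈ Set.Ioo e ⊤, S x y < ⊤)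
      (hmem : ∀ x, Par x e → cl x ∉ Set.Icc e ⊤) :
      (∀ x y, U x y = U y x) ∧ (∀ x y z, U (U x y) z = U x (U y z)) ∧
      (∀ x y z, x ≤ y → U x z ≤ U y z) ∧ (∀ x y z, x ≤ y → U z x ≤ U z y) ∧
      (∀ x, U e x = x) := by
    have hm := T.mono_left hcl hcl_le hle fun x hx y hy z hz =>
      hS_mono₁ x (hIcc x hx) y (hIcc y hy) z (hIcc z hz)
    refine ⟨T.comm, T.assoc he0 hcl hcl_le hcl_idem
      (fun x hx y hy => ⟨hx.1.trans_le (hle x hx y hy).1, hlt x hx y hy⟩)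
      (fun x hx y hy z hz => hS_assoc x (hIcc x hx) y (hIcc y hy) z (hIcc z hz)) hmem,
      hm, fun x y z hxy => ?_, T.unit⟩
    rw [T.comm z x, T.comm z y]
    exact hm x y z hxy
  exact ⟨fun hmem => ⟨fun h => T.mul_lt_top_of_assoc he0 h.2.1, fun hlt => hback hlt hmem⟩,
    fun hne => ⟨fun h => ⟨T.mul_lt_top_of_assoc he0 h.2.1,
      T.closure_notMem_of_assoc he0 hcl_le hne h.2.1⟩, fun h => hback h.1 h.2⟩⟩
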